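/- arXiv:2403.19410 — 2 statements merged into one kernel-verified Lean document; each statement's English description precedes it below -/
import Mathlib

section
/- Let Q ⊆ ℤ^n, Ψ : ℤ^n → (0,1/2], and 0 < s < s(Q,Ψ). Then there exists M₀ such that for all M ∈ 𝓜 with M ≥ M₀, |Q'(M)| ≥ M / (4 (log₂ M)^{n+1}). -/
noncomputable section

/-- `Ψ_*(q) = Ψ(q)/|q|` (max norm on `ℤ^n`). -/
def PsiStar {n : ℕ} (Ψ : (Fin n → ℤ) → ℝ) (q : Fin n → ℤ) : ℝ := Ψ q / ‖q‖

/-- `s(Q,Ψ) = inf {s ≥ 0 : ∑_{q ∈ Q} Ψ_*(q)^s < ∞}`. -/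
def sExp {n : ℕ} (Q : Set (Fin n → ℤ)) (Ψ : (Fin n → ℤ) → ℝ) : ℝ :=
  sInf {s : ℝ | 0 ≤ s ∧ Summable fun q : Q => PsiStar Ψ q ^ s}

/-- `Q(M) = {q ∈ Q : M/2 < Ψ_*(q)^{-s} ≤ M}`. -/
def QM {n : ℕ} (Q : Set (Fin n → ℤ)) (Ψ : (Fin n → ℤ) → ℝ) (s M : ℝ) : Set (Fin n → ℤ) :=
  {q | q ∈ Q ∧ M / 2 < PsiStar Ψ q ^ (-s) ∧ PsiStar Ψ q ^ (-s) ≤ M}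

/-- `𝓜 = {2^k : k ∈ ℕ, ∑_{q ∈ Q(2^k)} Ψ_*(q)^s ≥ k^{-(n+1)}}`. -/
def Mcal {n : ℕ} (Q : Set (Fin n → ℤ)) (Ψ : (Fin n → ℤ) → ℝ) (s : ℝ) : Set ℝ :=
  {M | ∃ k : ℕ, M = 2 ^ k ∧
    (((k : ℝ) ^ (n + 1))⁻¹ : ℝ) ≤ ∑' q : QM Q Ψ s (2 ^ k), PsiStar Ψ q ^ s}

end
/-- The set of divisors `D(ℓ) = {q ∈ ℤ^n : ∃ k ∈ ℤ^m, ℓ_{ij} = k_i q_j for all i,j}` of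
`ℓ ∈ ℤ^{mn}` (identified with an `m × n` integer matrix). -/
def Dset (m n : ℕ) (l : Fin m × Fin n → ℤ) : Set (Fin n → ℤ) :=
  {q | ∃ k : Fin m → ℤ, ∀ i j, l (i, j) = k i * q j}

/-- `L(M) = {ℓ ∈ ℤ^{mn} : 0 < |ℓ| ≤ (M/(2 (log₂ M)^{n+1}))^{1/(2mn)}}`. -/
noncomputable def LM (m n : ℕ) (M : ℝ) : Set (Fin m × Fin n → ℤ) :=
  {l | l ≠ 0 ∧ ‖l‖ ≤ (M / (2 * Real.logb 2 M ^ (n + 1))) ^ ((1 : ℝ) / (2 * m * n))}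

/-- `Q'(M) = Q(M) \ ⋃_{ℓ ∈ L(M)} D(ℓ)`. -/
noncomputable def QM' {n : ℕ} (m : ℕ) (Q : Set (Fin n → ℤ)) (Ψ : (Fin n → ℤ) → ℝ) (s M : ℝ) :
    Set (Fin n → ℤ) :=
  QM Q Ψ s M \ ⋃ l ∈ LM m n M, Dset m n l

/-- The number of integer vectors of max norm at most `X`, where `1 ≤ X`, is at most `(3X)^n`. -/
theorem finite_and_ncard_norm_le {n : ℕ} {X : ℝ} (hX : 1 ≤ X) :
    {q : Fin n → ℤ | ‖q‖ ≤ X}.Finite ∧ ({q : Fin n → ℤ | ‖q‖ ≤ X}.ncard : ℝ) ≤ (3 * X) ^ n := by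
  have hX0 : 0 ≤ X := by linarith
  set F : Finset (Fin n → ℤ) := Fintype.piFinset fun _ => Finset.Icc (-⌊X⌋) ⌊X⌋ with hF
  have hsub : {q : Fin n → ℤ | ‖q‖ ≤ X} ⊆ (F : Set (Fin n → ℤ)) := by
    intro q hq
    simp only [hF, Finset.mem_coe, Fintype.mem_piFinset, Finset.mem_Icc]
    intro i
    have h := (norm_le_pi_norm q i).trans hq
    rw [Int.norm_eq_abs, ← Int.cast_abs] at h
    exact abs_le.mp (Int.le_floor.mpr h)
  have hfin := F.finite_toSet.subset hsub
  refine ⟨hfin, ?_⟩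
  have hcard : ((F.card : ℕ) : ℝ) = (2 * (⌊X⌋ : ℝ) + 1) ^ n := by
    have h0 : 0 ≤ ⌊X⌋ := Int.floor_nonneg.mpr hX0
    have h1 : (((⌊X⌋ + 1 - -⌊X⌋).toNat : ℕ) : ℝ) = 2 * (⌊X⌋ : ℝ) + 1 := by
      have h2 : (((⌊X⌋ + 1 - -⌊X⌋).toNat : ℕ) : ℤ) = 2 * ⌊X⌋ + 1 := by omega
      exact_mod_cast h2
    simp [hF, Fintype.card_piFinset, ← h1]
  have hle : ({q : Fin n → ℤ | ‖q‖ ≤ X}.ncard : ℝ) ≤ F.card := by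
    rw [← Set.ncard_coe_finset F]
    exact_mod_cast Set.ncard_le_ncard hsub F.finite_toSet
  refine hle.trans (hcard.trans_le ?_)
  have h0 : (0 : ℝ) ≤ ⌊X⌋ := by exact_mod_cast Int.floor_nonneg.mpr hX0
  have h1 := Int.floor_le X
  gcongr
  linarith

/-- A divisor of a nonzero integer matrix has norm at most that of the matrix. -/
theorem norm_le_of_mem_Dset {m n : ℕ} {l : Fin m × Fin n → ℤ} (hl : l ≠ 0) {q : Fin n → ℤ}
    (hq : q ∈ Dset m n l) : ‖q‖ ≤ ‖l‖ := by
  obtain ⟨k, hk⟩ := hq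
  obtain ⟨⟨i, j⟩, hij⟩ := Function.ne_iff.mp hl
  have hki : k i ≠ 0 := by
    rintro h
    exact hij (by simp [hk, h])
  refine (pi_norm_le_iff_of_nonneg (norm_nonneg l)).mpr fun j' => ?_
  refine le_trans ?_ (norm_le_pi_norm l (i, j'))
  rw [hk, norm_mul]
  refine le_mul_of_one_le_left (norm_nonneg _) ?_
  rw [Int.norm_eq_abs]
  exact_mod_cast Int.one_le_abs hki

/-- For `T ≥ 4 · 9^n`, the divisors of the nonzero matrices of norm at most `T^{1/(2mn)}` form a
finite set of at most `T/2` elements. -/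
theorem exists_finite_divisors_ncard_le (m n : ℕ) {T : ℝ} (hT : 4 * 9 ^ n ≤ T) :
    ∃ B : Set (Fin n → ℤ), B.Finite ∧ (B.ncard : ℝ) ≤ T / 2 ∧
      ∀ l : Fin m × Fin n → ℤ, l ≠ 0 → ‖l‖ ≤ T ^ ((1 : ℝ) / (2 * m * n)) → Dset m n l ⊆ B := by
  have h9 : (1 : ℝ) ≤ 9 ^ n := one_le_pow₀ (by norm_num)
  have hT1 : 1 ≤ T := by linarith
  have hT0 : 0 ≤ T := by linarith
  rcases Nat.eq_zero_or_pos m with rfl | hm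
  · exact ⟨∅, Set.finite_empty, by simp; positivity,
      fun l hl => (hl (Subsingleton.elim _ _)).elim⟩
  rcases Nat.eq_zero_or_pos n with rfl | hn
  · exact ⟨∅, Set.finite_empty, by simp; positivity,
      fun l hl => (hl (Subsingleton.elim _ _)).elim⟩
  have hm1 : (1 : ℝ) ≤ m := by exact_mod_cast hm
  have hn1 : (1 : ℝ) ≤ n := by exact_mod_cast hn
  set X : ℝ := T ^ ((1 : ℝ) / (2 * m * n)) with hXdef
  have hX : 1 ≤ X := Real.one_le_rpow hT1 (by positivity)
  obtain ⟨hfin, hcard⟩ := finite_and_ncard_norm_le (n := n) hX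
  refine ⟨_, hfin, hcard.trans ?_, fun l hl hlX q hq => (norm_le_of_mem_Dset hl hq).trans hlX⟩
  have hXn : X ^ n ≤ √T := by
    rw [hXdef, ← Real.rpow_natCast, ← Real.rpow_mul hT0, Real.sqrt_eq_rpow]
    refine Real.rpow_le_rpow_of_exponent_le hT1 ?_
    rw [div_mul_eq_mul_div, div_le_div_iff₀ (by positivity) (by norm_num)]
    nlinarith
  have h3 : 2 * (3 : ℝ) ^ n ≤ √T := by
    refine Real.le_sqrt_of_sq_le (le_trans (le_of_eq ?_) hT)
    rw [mul_pow, ← pow_mul, mul_comm n 2, pow_mul]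
    norm_num
  have hsq : √T * √T = T := Real.mul_self_sqrt hT0
  calc (3 * X) ^ n = 3 ^ n * X ^ n := mul_pow _ _ _
    _ ≤ 3 ^ n * √T := by gcongr
    _ ≤ T / 2 := by nlinarith [Real.sqrt_nonneg T]

/-- Elements of `Q(M)`, for `M > 0`, are nonzero. -/
theorem ne_zero_of_mem_QM {n : ℕ} {Q : Set (Fin n → ℤ)} {Ψ : (Fin n → ℤ) → ℝ} {s M : ℝ}
    (hs : 0 < s) (hM : 0 < M) {q : Fin n → ℤ} (hq : q ∈ QM Q Ψ s M) : q ≠ 0 := by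
  rintro rfl
  have h := hq.2.1
  rw [PsiStar, norm_zero, div_zero, Real.zero_rpow (by linarith)] at h
  linarith

theorem QM_finite {n : ℕ} {Q : Set (Fin n → ℤ)} {Ψ : (Fin n → ℤ) → ℝ}
    (hΨ : ∀ q, Ψ q ∈ Set.Ioc (0 : ℝ) (1 / 2)) {s M : ℝ} (hs : 0 < s) (hM : 1 ≤ M) :
    (QM Q Ψ s M).Finite := by
  have hM0 : 0 < M := by linarith
  refine (finite_and_ncard_norm_le (n := n)
    (Real.one_le_rpow hM (inv_nonneg.mpr hs.le))).1.subset fun q hq => ?_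
  have hq0 : 0 < ‖q‖ := norm_pos_iff.mpr (ne_zero_of_mem_QM hs hM0 hq)
  have h := hq.2.2
  rw [PsiStar, Real.rpow_neg (div_pos (hΨ q).1 hq0).le,
    ← Real.inv_rpow (div_pos (hΨ q).1 hq0).le, inv_div] at h
  have h1 : ‖q‖ ≤ ‖q‖ / Ψ q :=
    le_div_self hq0.le (hΨ q).1 ((hΨ q).2.trans (by norm_num))
  exact h1.trans ((Real.le_rpow_inv_iff_of_pos (div_pos hq0 (hΨ q).1).le hM0.le hs).mpr h)

/-- The sum of `Ψ_*(q)^s` over `Q(M)` is at most `2|Q(M)|/M`. -/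
theorem tsum_QM_le {n : ℕ} {Q : Set (Fin n → ℤ)} {Ψ : (Fin n → ℤ) → ℝ}
    (hΨ : ∀ q, Ψ q ∈ Set.Ioc (0 : ℝ) (1 / 2)) {s M : ℝ} (hs : 0 < s) (hM : 1 ≤ M) :
    ∑' q : QM Q Ψ s M, PsiStar Ψ q ^ s ≤ (QM Q Ψ s M).ncard * (2 / M) := by
  have hM0 : 0 < M := by linarith
  have : Fintype (QM Q Ψ s M) := (QM_finite hΨ hs hM).fintype
  rw [tsum_fintype, ← Nat.card_coe_set_eq, Nat.card_eq_fintype_card, ← nsmul_eq_mul]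
  refine Finset.sum_le_card_nsmul _ _ _ fun q _ => ?_
  have h := q.2.2.1
  have hpos : 0 ≤ PsiStar Ψ q := div_nonneg (hΨ q).1.le (norm_nonneg _)
  rw [Real.rpow_neg hpos] at h
  have h2 := inv_anti₀ (by positivity) h.le
  rwa [inv_inv, inv_div] at h2

/-- For `0 < s < s(Q,Ψ)` there is `M₀` such that `|Q'(M)| ≥ M/(4 (log₂ M)^{n+1})` for all
`M ∈ 𝓜` with `M ≥ M₀`. -/
theorem QM'_card_ge (m n : ℕ) (Q : Set (Fin n → ℤ)) (Ψ : (Fin n → ℤ) → ℝ)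
    (hΨ : ∀ q, Ψ q ∈ Set.Ioc (0 : ℝ) (1 / 2)) (s : ℝ) (hs : 0 < s) (hss : s < sExp Q Ψ) :
    ∃ M₀ : ℝ, ∀ M ∈ Mcal Q Ψ s, M₀ ≤ M →
      M / (4 * Real.logb 2 M ^ (n + 1)) ≤ ((QM' m Q Ψ s M).ncard : ℝ) := by
  have hlim : Filter.Tendsto (fun k : ℕ => (2 : ℝ) ^ k / (2 * (k : ℝ) ^ (n + 1)))
      Filter.atTop Filter.atTop := by
    have h := (tendsto_pow_const_div_const_pow_of_one_lt (n + 1) (one_lt_two (α := ℝ)))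
    have h' : Filter.Tendsto (fun k : ℕ => (k : ℝ) ^ (n + 1) / (2 : ℝ) ^ k)
        Filter.atTop (nhdsWithin 0 (Set.Ioi 0)) := by
      refine tendsto_nhdsWithin_iff.mpr ⟨h, ?_⟩
      filter_upwards [Filter.eventually_gt_atTop 0] with k hk
      have : (0 : ℝ) < k := by exact_mod_cast hk
      exact Set.mem_Ioi.mpr (by positivity)
    refine (h'.inv_tendsto_nhdsGT_zero.atTop_div_const (two_pos (α := ℝ))).congr fun k => ?_
    simp only [Pi.inv_apply, inv_div]
    rw [div_div, mul_comm]
  obtain ⟨K, hK⟩ := Filter.eventually_atTop.mp (hlim.eventually_ge_atTop (4 * 9 ^ n))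
  refine ⟨2 ^ (K + 1), ?_⟩
  rintro _ ⟨k, rfl, hk⟩ hMk
  have hKk : K + 1 ≤ k := (pow_le_pow_iff_right₀ (one_lt_two (α := ℝ))).mp hMk
  have hk0 : (0 : ℝ) < k := by exact_mod_cast (by omega : 0 < k)
  have hlog : Real.logb 2 ((2 : ℝ) ^ k) = k := by
    rw [← Real.rpow_natCast, Real.logb_rpow (by norm_num) (by norm_num)]
  have hM1 : (1 : ℝ) ≤ 2 ^ k := one_le_pow₀ (by norm_num)
  obtain ⟨B, hBfin, hBcard, hB⟩ := exists_finite_divisors_ncard_le m n (hK k (by omega))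
  have hQM : (2 : ℝ) ^ k / (2 * (k : ℝ) ^ (n + 1)) ≤ (QM Q Ψ s (2 ^ k)).ncard := by
    have h := hk.trans (tsum_QM_le hΨ hs hM1)
    rw [mul_div_assoc', le_div_iff₀ (by positivity)] at h
    rw [← div_div, div_right_comm, div_le_iff₀ two_pos, div_eq_inv_mul]
    exact h
  have hsub : QM Q Ψ s (2 ^ k) \ B ⊆ QM' m Q Ψ s (2 ^ k) := by
    refine Set.sdiff_subset_sdiff_right (Set.iUnion₂_subset fun l hl => ?_)
    have hl2 := hl.2
    rw [hlog] at hl2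
    exact hB l hl.1 hl2
  have hfin : (QM Q Ψ s (2 ^ k)).Finite := QM_finite hΨ hs hM1
  have hdiff : ((QM Q Ψ s (2 ^ k)).ncard : ℝ) ≤ (QM' m Q Ψ s (2 ^ k)).ncard + B.ncard := by
    have h1 := Set.ncard_le_ncard_sdiff_add_ncard (QM Q Ψ s (2 ^ k)) B hBfin
    have h2 := Set.ncard_le_ncard hsub (hfin.subset Set.sdiff_subset)
    exact_mod_cast h1.trans (Nat.add_le_add_right h2 _)
  have hhalf : (2 : ℝ) ^ k / (4 * (k : ℝ) ^ (n + 1)) =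
      (2 : ℝ) ^ k / (2 * (k : ℝ) ^ (n + 1)) / 2 := by
    rw [div_div]
    ring
  rw [hlog, hhalf]
  linarith
end

section
/- Let M > 0 be such that Q'(M) is finite and nonempty, and let ℓ ∈ ℤ^{mn} be nonzero. Choose j₀ ∈ {1,…,n} with |ℓ| = |ℓ_{j₀}|, where ℓ_j = (ℓ_{1j},…,ℓ_{mj}). Then the ℓ-th Fourier coefficient of F_M satisfies F̂_M(ℓ) = |Q'(M)|^{−1} ∑_{q ∈ Q'(M) ∩ D(ℓ)} e^{−2πi q_{j₀}^{−1} ℓ_{j₀} · θ} φ̂(Ψ(q) q_{j₀}^{−1} ℓ_{j₀}). -/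
open MeasureTheory

/-- `w_s(t) = exp(s log t / log log t)`. -/
noncomputable def wfun (s t : ℝ) : ℝ := Real.exp (s * Real.log t / Real.log (Real.log t))
noncomputable section

/-- The Fourier transform on `ℝ^m`: `φ̂(ξ) = ∫ e^{-2πi x·ξ} φ(x) dx`. -/
def ftRm {m : ℕ} (φ : (Fin m → ℝ) → ℝ) (ξ : Fin m → ℝ) : ℂ :=
  ∫ x : Fin m → ℝ,
    Complex.exp (((-(2 * Real.pi * ∑ i, x i * ξ i) : ℝ) : ℂ) * Complex.I) * (φ x : ℂ)

/-- The `ℤ^m`-periodization `Φ^ε(y) = ∑_{r ∈ ℤ^m} ε^{-m} φ(ε^{-1}(y - r))`. -/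
def PhiEps {m : ℕ} (φ : (Fin m → ℝ) → ℝ) (ε : ℝ) (y : Fin m → ℝ) : ℝ :=
  ∑' r : Fin m → ℤ, (ε ^ m)⁻¹ * φ (fun i => (y i - (r i : ℝ)) / ε)

/-- `Φ^ε_{q,θ}(x) = Φ^ε(xq - θ)` for `x ∈ ℝ^{mn}` identified with an `m × n` matrix. -/
def PhiQ {m n : ℕ} (φ : (Fin m → ℝ) → ℝ) (ε : ℝ) (q : Fin n → ℤ) (θ : Fin m → ℝ)
    (x : Fin m × Fin n → ℝ) : ℝ :=
  PhiEps φ ε (fun i => (∑ j : Fin n, x (i, j) * (q j : ℝ)) - θ i)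

/-- The `ℓ`-th Fourier coefficient `∫_{[0,1]^{mn}} f(x) e^{-2πi ℓ·x} dx` of a
`ℤ^{mn}`-periodic function. -/
def fcoef {m n : ℕ} (f : (Fin m × Fin n → ℝ) → ℝ) (l : Fin m × Fin n → ℤ) : ℂ :=
  ∫ x in {x : Fin m × Fin n → ℝ | ∀ p, x p ∈ Set.Icc (0 : ℝ) 1},
    (f x : ℂ) * Complex.exp (((-(2 * Real.pi * ∑ p, x p * (l p : ℝ)) : ℝ) : ℂ) * Complex.I)

end
/-- `F_M(x) = |Q'|⁻¹ ∑_{q ∈ Q'} Φ^{Ψ(q)}_{q,θ}(x)`. -/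
noncomputable def FM {m n : ℕ} (φ : (Fin m → ℝ) → ℝ) (Ψ : (Fin n → ℤ) → ℝ) (θ : Fin m → ℝ)
    (Q' : Set (Fin n → ℤ)) (x : Fin m × Fin n → ℝ) : ℝ :=
  ((Q'.ncard : ℝ))⁻¹ * ∑' q : Q', PhiQ φ (Ψ q) q θ x

/-- The closed unit box `[0,1]^ι`. -/
def unitBox (ι : Type*) : Set (ι → ℝ) := {x | ∀ p, x p ∈ Set.Icc (0 : ℝ) 1}

/-- `f` is invariant under translation by integer vectors. -/
def IntPeriodic {ι E : Type*} (f : (ι → ℝ) → E) : Prop :=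
  ∀ (x : ι → ℝ) (r : ι → ℤ), f (fun p => x p + r p) = f x

/-- The projection of `ℝ^ι` onto the torus. -/
def torusMk {ι : Type*} (x : ι → ℝ) : UnitAddTorus ι := fun p => (x p : UnitAddCircle)

/-- The representative in `(0,1]^ι` of a point of the torus. -/
noncomputable def torusRep {ι : Type*} (y : UnitAddTorus ι) : ι → ℝ :=
  fun p => (AddCircle.measurableEquivIoc 1 0 (y p) : ℝ)

lemma measurable_torusRep {ι : Type*} : Measurable (torusRep (ι := ι)) :=
  measurable_pi_lambda _ fun p =>
    measurable_subtype_coe.comp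
      ((AddCircle.measurableEquivIoc 1 0).measurable.comp (measurable_pi_apply p))

lemma torusMk_torusRep {ι : Type*} (y : UnitAddTorus ι) : torusMk (torusRep y) = y :=
  funext fun p => (AddCircle.measurableEquivIoc 1 0).symm_apply_apply (y p)

lemma IntPeriodic.eq_of_torusMk_eq {ι E : Type*} {f : (ι → ℝ) → E} (hf : IntPeriodic f)
    {x y : ι → ℝ} (h : torusMk x = torusMk y) : f x = f y := by
  have h' : ∀ p, ∃ r : ℤ, y p = x p + r := by
    intro p
    have hp : (x p : UnitAddCircle) = (y p : UnitAddCircle) := congrFun h p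
    rw [QuotientAddGroup.eq] at hp
    obtain ⟨r, hr⟩ := AddSubgroup.mem_zmultiples_iff.1 hp
    refine ⟨r, ?_⟩
    rw [zsmul_eq_mul, mul_one] at hr
    linarith
  choose r hr using h'
  rw [show y = fun p => x p + r p from funext hr, hf]

lemma IntPeriodic.torusRep_torusMk {ι E : Type*} {f : (ι → ℝ) → E} (hf : IntPeriodic f)
    (x : ι → ℝ) : f (torusRep (torusMk x)) = f x :=
  hf.eq_of_torusMk_eq (torusMk_torusRep _)

lemma unitBox_ae_eq {ι : Type*} [Fintype ι] :
    (Set.univ.pi fun _ : ι => Set.Ioc (0 : ℝ) 1) =ᵐ[volume] unitBox ι := by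
  have h : unitBox ι = Set.Icc (0 : ι → ℝ) 1 := by
    ext x
    simp [unitBox, Pi.le_def, forall_and]
  rw [h]
  exact Measure.univ_pi_Ioc_ae_eq_Icc

lemma measurePreserving_torusMk {ι : Type*} [Fintype ι] :
    MeasurePreserving (torusMk (ι := ι)) (volume.restrict (unitBox ι)) volume := by
  rw [← Measure.restrict_congr_set unitBox_ae_eq, volume_pi, Measure.restrict_pi_pi]
  refine measurePreserving_pi (fun _ : ι => volume.restrict (Set.Ioc (0 : ℝ) 1)) _ fun _ => ?_
  simpa using UnitAddCircle.measurePreserving_mk 0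

lemma IntPeriodic.setIntegral_unitBox {ι : Type*} [Fintype ι] {f : (ι → ℝ) → ℂ}
    (hf : IntPeriodic f) (hm : Measurable f) :
    ∫ x in unitBox ι, f x = ∫ y : UnitAddTorus ι, f (torusRep y) := by
  rw [← measurePreserving_torusMk.map_eq, integral_map]
  · simp_rw [hf.torusRep_torusMk]
  · exact measurePreserving_torusMk.measurable.aemeasurable
  · exact (hm.comp measurable_torusRep).aestronglyMeasurable

lemma IntPeriodic.integrableOn_unitBox {ι : Type*} [Fintype ι] {f : (ι → ℝ) → ℂ}
    (hf : IntPeriodic f) (hm : Measurable f) :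
    IntegrableOn f (unitBox ι) ↔ Integrable fun y : UnitAddTorus ι => f (torusRep y) := by
  rw [← measurePreserving_torusMk.integrable_comp
    (g := fun y => f (torusRep y)) (hm.comp measurable_torusRep).aestronglyMeasurable]
  simp only [Function.comp_def, hf.torusRep_torusMk, IntegrableOn]

lemma IntPeriodic.setIntegral_unitBox_add {ι : Type*} [Fintype ι] {f : (ι → ℝ) → ℂ}
    (hf : IntPeriodic f) (hm : Measurable f) (v : ι → ℝ) :
    ∫ x in unitBox ι, f (fun p => x p + v p) = ∫ x in unitBox ι, f x := by
  have hf' : IntPeriodic fun x => f (fun p => x p + v p) := fun x r => by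
    simpa only [add_right_comm] using hf (fun p => x p + v p) r
  have hm' : Measurable fun x : ι → ℝ => f (fun p => x p + v p) := hm.comp (by fun_prop)
  rw [hf.setIntegral_unitBox hm, hf'.setIntegral_unitBox hm',
    ← integral_add_right_eq_self (fun y => f (torusRep y)) (torusMk v)]
  refine integral_congr_ae (Filter.Eventually.of_forall fun y => hf.eq_of_torusMk_eq ?_)
  rw [torusMk_torusRep]
  conv_rhs => rw [← torusMk_torusRep y]
  rfl

/-- A periodic function which a translation multiplies by a constant `c ≠ 1` has mean zero. -/
lemma IntPeriodic.setIntegral_unitBox_eq_zero {ι : Type*} [Fintype ι] {f : (ι → ℝ) → ℂ}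
    (hf : IntPeriodic f) (hm : Measurable f) {v : ι → ℝ} {c : ℂ} (hc : c ≠ 1)
    (hv : ∀ x, f (fun p => x p + v p) = c * f x) : ∫ x in unitBox ι, f x = 0 := by
  have h := hf.setIntegral_unitBox_add hm v
  simp_rw [hv, integral_const_mul] at h
  have h' : (c - 1) * ∫ x in unitBox ι, f x = 0 := by rw [sub_mul, h, one_mul, sub_self]
  exact (mul_eq_zero.1 h').resolve_left (sub_ne_zero.2 hc)

/-- The homomorphism `x ↦ xq` from `m × n` matrices over the circle to vectors. -/
def torusMulVec {m n : ℕ} (q : Fin n → ℤ) :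
    UnitAddTorus (Fin m × Fin n) →+ UnitAddTorus (Fin m) where
  toFun x i := ∑ j, q j • x (i, j)
  map_zero' := by ext; simp
  map_add' x y := by ext i; simp [Finset.sum_add_distrib]

/-- The product `xq` of a real `m × n` matrix and an integer vector. -/
def mulIntVec {m n : ℕ} (q : Fin n → ℤ) (x : Fin m × Fin n → ℝ) : Fin m → ℝ :=
  fun i => ∑ j, x (i, j) * (q j : ℝ)

lemma measurable_mulIntVec {m n : ℕ} (q : Fin n → ℤ) : Measurable (mulIntVec (m := m) q) := by
  unfold mulIntVec
  fun_prop

lemma torusMk_mulIntVec {m n : ℕ} (q : Fin n → ℤ) (x : Fin m × Fin n → ℝ) :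
    torusMk (mulIntVec q x) = torusMulVec q (torusMk x) := by
  funext i
  change ((QuotientAddGroup.mk' (AddSubgroup.zmultiples (1 : ℝ))) (∑ j, x (i, j) * (q j : ℝ))) =
    ∑ j, q j • (QuotientAddGroup.mk' (AddSubgroup.zmultiples (1 : ℝ))) (x (i, j))
  simp_rw [map_sum, ← map_zsmul, zsmul_eq_mul, mul_comm]

lemma mulIntVec_add {m n : ℕ} (q : Fin n → ℤ) (x v : Fin m × Fin n → ℝ) :
    mulIntVec q (fun p => x p + v p) = fun i => mulIntVec q x i + mulIntVec q v i := by
  funext i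
  simp [mulIntVec, add_mul, Finset.sum_add_distrib]

lemma mulIntVec_intCast {m n : ℕ} (q : Fin n → ℤ) (r : Fin m × Fin n → ℤ) :
    mulIntVec q (fun p => (r p : ℝ)) = fun i => ((∑ j, r (i, j) * q j : ℤ) : ℝ) := by
  funext i
  simp [mulIntVec]

lemma IntPeriodic.comp_mulIntVec {m n : ℕ} {E : Type*} {G : (Fin m → ℝ) → E}
    (hG : IntPeriodic G) (q : Fin n → ℤ) :
    IntPeriodic fun x : Fin m × Fin n → ℝ => G (mulIntVec q x) := fun x r => by
  simp only [mulIntVec_add q x fun p => (r p : ℝ), mulIntVec_intCast]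
  exact hG _ _

lemma torusMulVec_surjective {m n : ℕ} {q : Fin n → ℤ} (hq : q ≠ 0) :
    Function.Surjective (torusMulVec (m := m) q) := by
  obtain ⟨j, hj⟩ := Function.ne_iff.1 hq
  have hj' : (q j : ℝ) ≠ 0 := by exact_mod_cast hj
  intro y
  refine ⟨torusMk fun p => if p.2 = j then torusRep y p.1 / q j else 0, ?_⟩
  rw [← torusMk_mulIntVec]
  conv_rhs => rw [← torusMk_torusRep y]
  congr 1
  funext i
  simp [mulIntVec, hj']

lemma measurePreserving_torusMulVec {m n : ℕ} {q : Fin n → ℤ} (hq : q ≠ 0) :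
    MeasurePreserving (torusMulVec (m := m) q) volume volume := by
  refine AddMonoidHom.measurePreserving ?_ (torusMulVec_surjective hq)
    (by simp only [volume_pi, Measure.pi_univ]; simp)
  change Continuous fun (x : UnitAddTorus (Fin m × Fin n)) i => ∑ j, q j • x (i, j)
  fun_prop

lemma IntPeriodic.mulIntVec_torusRep {m n : ℕ} {E : Type*} {G : (Fin m → ℝ) → E}
    (hG : IntPeriodic G) (q : Fin n → ℤ) (y : UnitAddTorus (Fin m × Fin n)) :
    G (mulIntVec q (torusRep y)) = G (torusRep (torusMulVec q y)) :=
  hG.eq_of_torusMk_eq (by rw [torusMk_mulIntVec, torusMk_torusRep, torusMk_torusRep])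

lemma IntPeriodic.setIntegral_comp_mulIntVec {m n : ℕ} {G : (Fin m → ℝ) → ℂ}
    (hG : IntPeriodic G) (hm : Measurable G) {q : Fin n → ℤ} (hq : q ≠ 0) :
    ∫ x in unitBox (Fin m × Fin n), G (mulIntVec q x) = ∫ y in unitBox (Fin m), G y := by
  rw [hG.setIntegral_unitBox hm, (hG.comp_mulIntVec q).setIntegral_unitBox
    (hm.comp (measurable_mulIntVec q)), ← (measurePreserving_torusMulVec hq).map_eq, integral_map]
  · simp_rw [hG.mulIntVec_torusRep]
  · exact (measurePreserving_torusMulVec hq).measurable.aemeasurable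
  · exact (hm.comp measurable_torusRep).aestronglyMeasurable

lemma IntPeriodic.integrableOn_comp_mulIntVec {m n : ℕ} {G : (Fin m → ℝ) → ℂ}
    (hG : IntPeriodic G) (hm : Measurable G) {q : Fin n → ℤ} (hq : q ≠ 0)
    (hi : IntegrableOn G (unitBox (Fin m))) :
    IntegrableOn (fun x => G (mulIntVec q x)) (unitBox (Fin m × Fin n)) := by
  rw [hG.integrableOn_unitBox hm] at hi
  rw [(hG.comp_mulIntVec q).integrableOn_unitBox (hm.comp (measurable_mulIntVec q))]
  simp_rw [hG.mulIntVec_torusRep]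
  exact (measurePreserving_torusMulVec hq).integrable_comp_of_integrable hi

/-- The translates of the half-open unit box by integer vectors cover the space. -/
lemma iUnion_translate_box {ι : Type*} :
    ⋃ r : ι → ℤ, (fun (y : ι → ℝ) p => y p + (r p : ℝ)) ⁻¹' (Set.univ.pi fun _ : ι => Set.Ioc (0 : ℝ) 1)
      = Set.univ := by
  refine Set.eq_univ_of_forall fun y => Set.mem_iUnion.2 ⟨fun p => 1 - ⌈y p⌉, fun p _ => ?_⟩
  have h1 := Int.ceil_lt_add_one (y p)
  have h2 := Int.le_ceil (y p)
  push_cast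
  constructor <;> linarith

lemma pairwise_disjoint_translate_box {ι : Type*} :
    Pairwise (Function.onFun Disjoint fun r : ι → ℤ =>
      (fun (y : ι → ℝ) p => y p + (r p : ℝ)) ⁻¹' (Set.univ.pi fun _ : ι => Set.Ioc (0 : ℝ) 1)) := by
  intro r s hrs
  refine Set.disjoint_left.2 fun y hr hs => hrs (funext fun p => ?_)
  obtain ⟨h1, h2⟩ := hr p trivial
  obtain ⟨h3, h4⟩ := hs p trivial
  have h5 : (r p : ℝ) < s p + 1 := by linarith
  have h6 : (s p : ℝ) < r p + 1 := by linarith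
  have h7 : r p < s p + 1 := by exact_mod_cast h5
  have h8 : s p < r p + 1 := by exact_mod_cast h6
  omega

lemma measurableSet_translate_box {ι : Type*} [Fintype ι] (r : ι → ℤ) :
    MeasurableSet ((fun (y : ι → ℝ) p => y p + (r p : ℝ)) ⁻¹'
      (Set.univ.pi fun _ : ι => Set.Ioc (0 : ℝ) 1)) :=
  (MeasurableSet.univ_pi fun _ => measurableSet_Ioc).preimage (by fun_prop)

lemma tsum_setLIntegral_unitBox {ι : Type*} [Fintype ι] (f : (ι → ℝ) → ENNReal) :
    ∑' r : ι → ℤ, ∫⁻ y in unitBox ι, f (fun p => y p - r p) = ∫⁻ y, f y := by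
  rw [← setLIntegral_univ, ← iUnion_translate_box,
    lintegral_iUnion measurableSet_translate_box pairwise_disjoint_translate_box]
  refine tsum_congr fun r => ?_
  rw [← Measure.restrict_congr_set unitBox_ae_eq]
  have h := (measurePreserving_add_right volume fun p => (r p : ℝ)).setLIntegral_comp_preimage_emb
    (measurableEmbedding_addRight _) (fun y : ι → ℝ => f (fun p => y p - r p))
    (Set.univ.pi fun _ : ι => Set.Ioc (0 : ℝ) 1)
  rw [← h]
  simp only [Pi.add_apply, add_sub_cancel_right]
  rfl

lemma tsum_setIntegral_unitBox {ι : Type*} [Fintype ι] {f : (ι → ℝ) → ℂ} (hf : Integrable f) :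
    ∑' r : ι → ℤ, ∫ y in unitBox ι, f (fun p => y p - r p) = ∫ y, f y := by
  rw [← setIntegral_univ, ← iUnion_translate_box,
    integral_iUnion measurableSet_translate_box pairwise_disjoint_translate_box hf.integrableOn]
  refine tsum_congr fun r => ?_
  rw [← Measure.restrict_congr_set unitBox_ae_eq]
  have h := (measurePreserving_add_right volume fun p => (r p : ℝ)).setIntegral_preimage_emb
    (measurableEmbedding_addRight _) (fun y : ι → ℝ => f (fun p => y p - r p))
    (Set.univ.pi fun _ : ι => Set.Ioc (0 : ℝ) 1)
  rw [← h]
  simp only [Pi.add_apply, add_sub_cancel_right]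
  rfl

lemma integrableOn_periodization {ι : Type*} [Fintype ι] {f : (ι → ℝ) → ℂ}
    (hm : Measurable f) (hf : Integrable f) :
    IntegrableOn (fun y => ∑' r : ι → ℤ, f (fun p => y p - r p)) (unitBox ι) := by
  have hm' (r : ι → ℤ) : Measurable fun y : ι → ℝ => f (fun p => y p - r p) :=
    hm.comp (by fun_prop)
  refine ⟨(Measurable.tsum hm').aestronglyMeasurable, ?_⟩
  refine lt_of_le_of_lt (lintegral_mono fun y => enorm_tsum_le_tsum_enorm) ?_
  rw [lintegral_tsum fun r => (hm' r).enorm.aemeasurable,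
    tsum_setLIntegral_unitBox fun y => ‖f y‖ₑ]
  exact hf.2

lemma setIntegral_periodization {ι : Type*} [Fintype ι] {f : (ι → ℝ) → ℂ}
    (hm : Measurable f) (hf : Integrable f) :
    ∫ y in unitBox ι, ∑' r : ι → ℤ, f (fun p => y p - r p) = ∫ y, f y := by
  have hm' (r : ι → ℤ) : Measurable fun y : ι → ℝ => f (fun p => y p - r p) :=
    hm.comp (by fun_prop)
  rw [integral_tsum fun r => (hm' r).aestronglyMeasurable, tsum_setIntegral_unitBox hf]
  rw [tsum_setLIntegral_unitBox fun y => ‖f y‖ₑ]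
  exact hf.2.ne

/-- The conjugate character `x ↦ e^{-2πi k·x}` of `ℝ^ι`. -/
noncomputable def conjChar {ι : Type*} [Fintype ι] (k x : ι → ℝ) : ℂ :=
  Complex.exp (((-(2 * Real.pi * ∑ p, x p * k p) : ℝ) : ℂ) * Complex.I)

lemma measurable_conjChar {ι : Type*} [Fintype ι] (k : ι → ℝ) : Measurable (conjChar k) := by
  unfold conjChar
  fun_prop

lemma norm_conjChar {ι : Type*} [Fintype ι] (k x : ι → ℝ) : ‖conjChar k x‖ = 1 :=
  Complex.norm_exp_ofReal_mul_I _

lemma conjChar_add {ι : Type*} [Fintype ι] (k x v : ι → ℝ) :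
    conjChar k (fun p => x p + v p) = conjChar k x * conjChar k v := by
  rw [conjChar, conjChar, conjChar, ← Complex.exp_add]
  simp only [add_mul, Finset.sum_add_distrib]
  push_cast
  ring_nf

lemma conjChar_eq_one_iff {ι : Type*} [Fintype ι] (k x : ι → ℝ) :
    conjChar k x = 1 ↔ ∃ N : ℤ, ∑ p, x p * k p = N := by
  rw [conjChar, Complex.exp_eq_one_iff]
  have hpi : (2 * Real.pi : ℝ) ≠ 0 := by positivity
  have key (a : ℝ) (N : ℤ) : ((-(2 * Real.pi * a) : ℝ) : ℂ) * Complex.I =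
      N * (2 * Real.pi * Complex.I) ↔ a = ((-N : ℤ) : ℝ) := by
    have : (N : ℂ) * (2 * Real.pi * Complex.I) = ((2 * Real.pi * N : ℝ) : ℂ) * Complex.I := by
      push_cast; ring
    rw [this, mul_left_inj' Complex.I_ne_zero, Complex.ofReal_inj, ← mul_neg,
      mul_right_inj' hpi]
    push_cast
    constructor <;> intro h <;> linarith
  simp_rw [key]
  exact ⟨fun ⟨N, h⟩ => ⟨-N, h⟩, fun ⟨N, h⟩ => ⟨-N, by rw [neg_neg, h]⟩⟩

lemma conjChar_intCast {ι : Type*} [Fintype ι] (k r : ι → ℤ) :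
    conjChar (fun p => (k p : ℝ)) (fun p => (r p : ℝ)) = 1 :=
  (conjChar_eq_one_iff _ _).2 ⟨∑ p, r p * k p, by push_cast; rfl⟩

lemma intPeriodic_conjChar {ι : Type*} [Fintype ι] (k : ι → ℤ) :
    IntPeriodic (conjChar fun p => (k p : ℝ)) := fun x r => by
  rw [conjChar_add _ x fun p => (r p : ℝ), conjChar_intCast, mul_one]

/-- The function `Φ^ε` is `ℤ^m`-periodic. -/
lemma intPeriodic_PhiEps {m : ℕ} (φ : (Fin m → ℝ) → ℝ) (ε : ℝ) : IntPeriodic (PhiEps φ ε) := by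
  intro x s
  rw [PhiEps, ← (Equiv.addRight s).tsum_eq]
  refine tsum_congr fun r => ?_
  simp [add_sub_add_right_eq_sub]

lemma measurable_PhiEps {m : ℕ} {φ : (Fin m → ℝ) → ℝ} (hφ : Measurable φ) (ε : ℝ) :
    Measurable (PhiEps φ ε) :=
  Measurable.tsum fun r : Fin m → ℤ => by
    have h : Measurable fun (y : Fin m → ℝ) i => (y i - (r i : ℝ)) / ε := by fun_prop
    exact (hφ.comp h).const_mul _

/-- The rescaled density `y ↦ ε^{-m} φ((y - θ)/ε) e^{-2πi k·y}`. -/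
noncomputable def modulatedBump {m : ℕ} (φ : (Fin m → ℝ) → ℝ) (ε : ℝ) (θ k y : Fin m → ℝ) : ℂ :=
  (((ε ^ m)⁻¹ * φ (fun i => (y i - θ i) / ε) : ℝ) : ℂ) * conjChar k y

lemma measurable_modulatedBump {m : ℕ} {φ : (Fin m → ℝ) → ℝ} (hφ : Measurable φ) (ε : ℝ)
    (θ k : Fin m → ℝ) : Measurable (modulatedBump φ ε θ k) :=
  (Complex.measurable_ofReal.comp ((hφ.comp (by fun_prop)).const_mul _)).mul
    (measurable_conjChar k)

lemma integrable_modulatedBump {m : ℕ} {φ : (Fin m → ℝ) → ℝ} (hφ : Integrable φ) {ε : ℝ}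
    (hε : 0 < ε) (θ k : Fin m → ℝ) : Integrable (modulatedBump φ ε θ k) := by
  have h1 : Integrable fun y : Fin m → ℝ => φ (fun i => (y i - θ i) / ε) := by
    have h := (hφ.comp_smul (inv_ne_zero hε.ne')).comp_sub_right θ
    refine h.congr (Filter.Eventually.of_forall fun y => ?_)
    change φ _ = φ _
    congr 1
    funext i
    simp [div_eq_inv_mul]
  refine ((h1.const_mul ((ε ^ m)⁻¹)).ofReal (𝕜 := ℂ)).mul_of_top_left ?_
  exact memLp_top_of_bound (measurable_conjChar k).aestronglyMeasurable 1
    (Filter.Eventually.of_forall fun y => (norm_conjChar k y).le)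

lemma tsum_modulatedBump {m : ℕ} (φ : (Fin m → ℝ) → ℝ) (ε : ℝ) (θ : Fin m → ℝ) (k : Fin m → ℤ)
    (y : Fin m → ℝ) :
    ∑' r : Fin m → ℤ, modulatedBump φ ε θ (fun i => (k i : ℝ)) (fun i => y i - r i) =
      (PhiEps φ ε (fun i => y i - θ i) : ℂ) * conjChar (fun i => (k i : ℝ)) y := by
  rw [PhiEps, Complex.ofReal_tsum, ← tsum_mul_right]
  refine tsum_congr fun r => ?_
  have h := intPeriodic_conjChar k y (-r)
  simp only [Pi.neg_apply, Int.cast_neg, ← sub_eq_add_neg] at h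
  simp only [modulatedBump, h, sub_right_comm]

lemma integral_modulatedBump {m : ℕ} (φ : (Fin m → ℝ) → ℝ) {ε : ℝ} (hε : 0 < ε)
    (θ k : Fin m → ℝ) :
    ∫ y, modulatedBump φ ε θ k y = conjChar k θ * ftRm φ (fun i => ε * k i) := by
  have h1 : ∫ y, modulatedBump φ ε θ k y =
      ∫ y : Fin m → ℝ, (((ε ^ m)⁻¹ : ℝ) : ℂ) * (conjChar k θ *
        (conjChar k (fun i => ε * (ε⁻¹ • y) i) * (φ (ε⁻¹ • y) : ℂ))) := by
    rw [← integral_sub_right_eq_self (fun y : Fin m → ℝ => (((ε ^ m)⁻¹ : ℝ) : ℂ) *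
      (conjChar k θ * (conjChar k (fun i => ε * (ε⁻¹ • y) i) * (φ (ε⁻¹ • y) : ℂ)))) θ]
    refine integral_congr_ae (Filter.Eventually.of_forall fun y => ?_)
    have hy : conjChar k y = conjChar k θ * conjChar k (fun i => y i - θ i) := by
      rw [← conjChar_add]; simp
    have e1 : (fun i => ε * (ε⁻¹ • (y - θ)) i) = fun i => y i - θ i := by
      funext i; simp [hε.ne']
    have e2 : ε⁻¹ • (y - θ) = fun i => (y i - θ i) / ε := by
      funext i; simp [div_eq_inv_mul]
    simp only [modulatedBump]
    rw [e1, e2, hy]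
    push_cast
    ring
  rw [h1, integral_const_mul, integral_const_mul, Measure.integral_comp_inv_smul volume
    (fun x : Fin m → ℝ => conjChar k (fun i => ε * x i) * (φ x : ℂ)) ε]
  have h2 : ∫ x : Fin m → ℝ, conjChar k (fun i => ε * x i) * (φ x : ℂ) =
      ftRm φ (fun i => ε * k i) := by
    rw [ftRm]
    congr 1
    funext x
    rw [conjChar]
    congr 6
    refine Finset.sum_congr rfl fun i _ => ?_
    ring
  have hε' : (ε : ℂ) ≠ 0 := by exact_mod_cast hε.ne'
  rw [h2, Module.finrank_fin_fun, abs_of_pos (pow_pos hε m), Complex.real_smul]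
  push_cast
  field_simp

lemma integrableOn_PhiEps_mul_conjChar {m : ℕ} {φ : (Fin m → ℝ) → ℝ} (hm : Measurable φ)
    (hφ : Integrable φ) {ε : ℝ} (hε : 0 < ε) (θ : Fin m → ℝ) (k : Fin m → ℤ) :
    IntegrableOn (fun y => (PhiEps φ ε (fun i => y i - θ i) : ℂ) *
      conjChar (fun i => (k i : ℝ)) y) (unitBox (Fin m)) := by
  simp_rw [← tsum_modulatedBump]
  exact integrableOn_periodization (measurable_modulatedBump hm ε θ _)
    (integrable_modulatedBump hφ hε θ _)

lemma setIntegral_PhiEps_mul_conjChar {m : ℕ} {φ : (Fin m → ℝ) → ℝ} (hm : Measurable φ)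
    (hφ : Integrable φ) {ε : ℝ} (hε : 0 < ε) (θ : Fin m → ℝ) (k : Fin m → ℤ) :
    ∫ y in unitBox (Fin m), (PhiEps φ ε (fun i => y i - θ i) : ℂ) *
      conjChar (fun i => (k i : ℝ)) y =
      conjChar (fun i => (k i : ℝ)) θ * ftRm φ (fun i => ε * k i) := by
  simp_rw [← tsum_modulatedBump]
  rw [setIntegral_periodization (measurable_modulatedBump hm ε θ _)
    (integrable_modulatedBump hφ hε θ _), integral_modulatedBump φ hε]

lemma intPeriodic_PhiEps_sub {m : ℕ} (φ : (Fin m → ℝ) → ℝ) (ε : ℝ) (θ : Fin m → ℝ) :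
    IntPeriodic fun y => PhiEps φ ε (fun i => y i - θ i) := fun y r => by
  simpa only [sub_add_eq_add_sub] using intPeriodic_PhiEps φ ε (fun i => y i - θ i) r

lemma measurable_PhiEps_sub {m : ℕ} {φ : (Fin m → ℝ) → ℝ} (hφ : Measurable φ) (ε : ℝ)
    (θ : Fin m → ℝ) : Measurable fun y : Fin m → ℝ => PhiEps φ ε (fun i => y i - θ i) :=
  (measurable_PhiEps hφ ε).comp (by fun_prop)

lemma isFiniteMeasure_restrict_unitBox (ι : Type*) [Fintype ι] :
    IsFiniteMeasure ((volume : Measure (ι → ℝ)).restrict (unitBox ι)) := by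
  refine ⟨?_⟩
  rw [← Set.preimage_univ (f := torusMk (ι := ι)),
    measurePreserving_torusMk.measure_preimage MeasurableSet.univ.nullMeasurableSet]
  exact measure_lt_top _ _

lemma PhiQ_eq {m n : ℕ} (φ : (Fin m → ℝ) → ℝ) (ε : ℝ) (q : Fin n → ℤ) (θ : Fin m → ℝ)
    (x : Fin m × Fin n → ℝ) :
    PhiQ φ ε q θ x = PhiEps φ ε (fun i => mulIntVec q x i - θ i) := rfl

lemma measurable_PhiQ {m n : ℕ} {φ : (Fin m → ℝ) → ℝ} (hφ : Measurable φ) (ε : ℝ)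
    (q : Fin n → ℤ) (θ : Fin m → ℝ) : Measurable (PhiQ φ ε q θ) :=
  (measurable_PhiEps_sub hφ ε θ).comp (measurable_mulIntVec q)

lemma integrableOn_PhiQ_mul_conjChar {m n : ℕ} {φ : (Fin m → ℝ) → ℝ} (hm : Measurable φ)
    (hφ : Integrable φ) {ε : ℝ} (hε : 0 < ε) (q : Fin n → ℤ) (θ : Fin m → ℝ)
    (k : Fin m × Fin n → ℝ) :
    IntegrableOn (fun x => (PhiQ φ ε q θ x : ℂ) * conjChar k x) (unitBox (Fin m × Fin n)) := by
  have hbase : IntegrableOn (fun x => (PhiQ φ ε q θ x : ℂ)) (unitBox (Fin m × Fin n)) := by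
    rcases eq_or_ne q 0 with rfl | hq
    · have := isFiniteMeasure_restrict_unitBox (Fin m × Fin n)
      simp only [PhiQ, Pi.zero_apply, Int.cast_zero, mul_zero, Finset.sum_const_zero]
      exact integrable_const _
    · have hi := integrableOn_PhiEps_mul_conjChar hm hφ hε θ 0
      have h1 (y : Fin m → ℝ) : conjChar (fun i => (((0 : Fin m → ℤ) i : ℤ) : ℝ)) y = 1 := by
        simp [conjChar]
      simp only [h1, mul_one] at hi
      exact IntPeriodic.integrableOn_comp_mulIntVec
        (fun y r => congrArg Complex.ofReal (intPeriodic_PhiEps_sub φ ε θ y r))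
        (Complex.measurable_ofReal.comp (measurable_PhiEps_sub hm ε θ)) hq hi
  refine Integrable.mul_of_top_left hbase ?_
  exact memLp_top_of_bound (measurable_conjChar k).aestronglyMeasurable 1
    (Filter.Eventually.of_forall fun y => (norm_conjChar k y).le)

/-- If `ℓ` is not of the form `k qᵀ`, some `v` with `vq` integral has `ℓ·v` not integral. -/
lemma exists_mulIntVec_int_of_notMem_Dset {m n : ℕ} {l : Fin m × Fin n → ℤ} {q : Fin n → ℤ}
    (h : q ∉ Dset m n l) :
    ∃ v : Fin m × Fin n → ℝ, (∃ s : Fin m → ℤ, mulIntVec q v = fun i => (s i : ℝ)) ∧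
      ¬ ∃ N : ℤ, ∑ p, v p * (l p : ℝ) = N := by
  classical
  by_contra! hcon
  -- matrices supported on a single row already detect every relation
  have hpair (i : Fin m) (w : Fin n → ℝ) (s : ℤ) (hw : ∑ j, w j * (q j : ℝ) = s) :
      ∃ N : ℤ, ∑ j, w j * (l (i, j) : ℝ) = N := by
    obtain ⟨N, hN⟩ := hcon (fun p => if p.1 = i then w p.2 else 0)
      ⟨fun i' => if i' = i then s else 0, by
        funext i'
        by_cases hi : i' = i
        · simp [mulIntVec, hi, hw]
        · simp [mulIntVec, hi]⟩
    refine ⟨N, ?_⟩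
    rw [← hN, Fintype.sum_prod_type, Finset.sum_eq_single i]
    · simp
    · intro i' _ hi
      simp [hi]
    · simp
  apply h
  rcases eq_or_ne q 0 with rfl | hq
  · refine ⟨0, fun i j => ?_⟩
    by_contra hl
    replace hl : l (i, j) ≠ 0 := by simpa using hl
    have hl' : (l (i, j) : ℝ) ≠ 0 := by exact_mod_cast hl
    obtain ⟨N, hN⟩ := hpair i (fun j' => if j' = j then 1 / (2 * l (i, j)) else 0) 0 (by simp)
    have hN' : (1 : ℝ) = 2 * N := by
      rw [← hN]
      simp
      field_simp
    have : (1 : ℤ) = 2 * N := by exact_mod_cast hN'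
    omega
  · obtain ⟨j, hj⟩ := Function.ne_iff.1 hq
    have hj' : (q j : ℝ) ≠ 0 := by exact_mod_cast hj
    have hk (i : Fin m) : ∃ k : ℤ, l (i, j) = k * q j := by
      obtain ⟨N, hN⟩ := hpair i (fun j' => if j' = j then 1 / q j else 0) 1 (by simp [hj'])
      refine ⟨N, ?_⟩
      have : (l (i, j) : ℝ) = N * q j := by
        rw [← hN]
        simp
        field_simp
      exact_mod_cast this
    choose k hk using hk
    refine ⟨k, fun i j' => ?_⟩
    by_contra hne
    have hd : (l (i, j') * q j - l (i, j) * q j' : ℤ) ≠ 0 := by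
      rw [hk i]
      intro h0
      have h1 : (l (i, j') - k i * q j') * q j = 0 := by linarith
      exact hne (sub_eq_zero.1 ((mul_eq_zero.1 h1).resolve_right hj))
    set d : ℤ := l (i, j') * q j - l (i, j) * q j' with hdd
    have hd' : (d : ℝ) ≠ 0 := by exact_mod_cast hd
    obtain ⟨N, hN⟩ := hpair i (fun a => (1 / (2 * d)) *
      ((if a = j' then (q j : ℝ) else 0) - if a = j then (q j' : ℝ) else 0)) 0 (by
        simp only [mul_assoc, ← Finset.mul_sum, sub_mul, Finset.sum_sub_distrib, ite_mul,
          zero_mul, Finset.sum_ite_eq', Finset.mem_univ, if_true]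
        simp [mul_comm])
    have hN' : (1 : ℝ) = 2 * N := by
      rw [← hN]
      simp only [mul_assoc, ← Finset.mul_sum, sub_mul, Finset.sum_sub_distrib, ite_mul,
          zero_mul, Finset.sum_ite_eq', Finset.mem_univ, if_true]
      have : (q j : ℝ) * l (i, j') - q j' * l (i, j) = d := by
        rw [hdd]; push_cast; ring
      rw [this]
      field_simp
    have : (1 : ℤ) = 2 * N := by exact_mod_cast hN'
    omega

lemma fcoef_eq {m n : ℕ} (f : (Fin m × Fin n → ℝ) → ℝ) (l : Fin m × Fin n → ℤ) :
    fcoef f l = ∫ x in unitBox (Fin m × Fin n), (f x : ℂ) * conjChar (fun p => (l p : ℝ)) x := rfl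

lemma fcoef_PhiQ_of_notMem {m n : ℕ} {φ : (Fin m → ℝ) → ℝ} (hm : Measurable φ) (ε : ℝ)
    {q : Fin n → ℤ} (θ : Fin m → ℝ) {l : Fin m × Fin n → ℤ} (hq : q ∉ Dset m n l) :
    fcoef (PhiQ φ ε q θ) l = 0 := by
  obtain ⟨v, ⟨s, hs⟩, hv⟩ := exists_mulIntVec_int_of_notMem_Dset hq
  have hper := (intPeriodic_PhiEps_sub φ ε θ).comp_mulIntVec q
  rw [fcoef_eq]
  refine IntPeriodic.setIntegral_unitBox_eq_zero (v := v) (c := conjChar (fun p => (l p : ℝ)) v)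
    ?_ ?_ ?_ ?_
  · intro x r
    simp only [PhiQ_eq]
    rw [intPeriodic_conjChar l x r]
    exact congrArg (fun t : ℝ => (t : ℂ) * _) (hper x r)
  · exact (Complex.measurable_ofReal.comp (measurable_PhiQ hm ε q θ)).mul (measurable_conjChar _)
  · rwa [Ne, conjChar_eq_one_iff]
  · intro x
    have h : PhiQ φ ε q θ (fun p => x p + v p) = PhiQ φ ε q θ x := by
      rw [PhiQ_eq, PhiQ_eq, mulIntVec_add, hs]
      exact intPeriodic_PhiEps_sub φ ε θ (mulIntVec q x) s
    rw [conjChar_add, h]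
    ring

lemma fcoef_PhiQ_of_eq {m n : ℕ} {φ : (Fin m → ℝ) → ℝ} (hm : Measurable φ) (hφ : Integrable φ)
    {ε : ℝ} (hε : 0 < ε) {q : Fin n → ℤ} (hq : q ≠ 0) (θ : Fin m → ℝ)
    {l : Fin m × Fin n → ℤ} {k : Fin m → ℤ} (hk : ∀ i j, l (i, j) = k i * q j) :
    fcoef (PhiQ φ ε q θ) l =
      conjChar (fun i => (k i : ℝ)) θ * ftRm φ (fun i => ε * k i) := by
  have hchar (x : Fin m × Fin n → ℝ) :
      conjChar (fun p => (l p : ℝ)) x = conjChar (fun i => (k i : ℝ)) (mulIntVec q x) := by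
    rw [conjChar, conjChar]
    congr 4
    rw [Fintype.sum_prod_type]
    congr 1
    refine Finset.sum_congr rfl fun i _ => ?_
    rw [mulIntVec, Finset.sum_mul]
    refine Finset.sum_congr rfl fun j _ => ?_
    rw [hk]
    push_cast
    ring
  rw [fcoef_eq, ← setIntegral_PhiEps_mul_conjChar hm hφ hε]
  simp only [hchar, PhiQ_eq]
  refine IntPeriodic.setIntegral_comp_mulIntVec (G := fun y => (PhiEps φ ε (fun i => y i - θ i) : ℂ)
    * conjChar (fun i => (k i : ℝ)) y) ?_ ?_ hq
  · intro y r
    simp only [intPeriodic_PhiEps_sub φ ε θ y r, intPeriodic_conjChar k y r]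
  · exact (Complex.measurable_ofReal.comp (measurable_PhiEps_sub hm ε θ)).mul
      (measurable_conjChar _)

/-- Fourier coefficients of `F_M`: for nonzero `ℓ` with max norm attained in column `j₀`,
`F̂_M(ℓ) = |Q'(M)|⁻¹ ∑_{q ∈ Q'(M) ∩ D(ℓ)} e^{-2πi (ℓ_{j₀}·θ)/q_{j₀}} φ̂(Ψ(q) ℓ_{j₀}/q_{j₀})`. -/
theorem FM_fourierCoeff (m n : ℕ) (φ : (Fin m → ℝ) → ℝ)
    (hφ0 : ∀ x, 0 ≤ φ x) (hmeas : Measurable φ)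
    (hsupp : Function.support φ ⊆ {x | ∀ i, x i ∈ Set.Ioo (-1 : ℝ) 1})
    (hint : ∫ x : Fin m → ℝ, φ x = 1)
    (K : ℕ) (hK : m < K) (C : ℝ)
    (hdecay : ∀ ξ : Fin m → ℝ, ‖ftRm φ ξ‖ ≤ C * (1 + ‖ξ‖) ^ (-(K : ℝ)))
    (Ψ : (Fin n → ℤ) → ℝ) (hΨ : ∀ q, Ψ q ∈ Set.Ioc (0 : ℝ) (1 / 2)) (θ : Fin m → ℝ)
    (Q' : Set (Fin n → ℤ)) (hfin : Q'.Finite) (hne : Q'.Nonempty)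
    (l : Fin m × Fin n → ℤ) (hl : l ≠ 0)
    (j₀ : Fin n) (hmax : ∃ i₀ : Fin m, ∀ p, |l p| ≤ |l (i₀, j₀)|) :
    fcoef (FM φ Ψ θ Q') l = ((Q'.ncard : ℝ) : ℂ)⁻¹ *
      ∑' q : ↥(Q' ∩ Dset m n l),
        Complex.exp
            (((-(2 * Real.pi * ((∑ i : Fin m, (l (i, j₀) : ℝ) * θ i) / ((q : Fin n → ℤ) j₀ : ℝ)))
              : ℝ) : ℂ) * Complex.I) *
          ftRm φ (fun i => Ψ q * (l (i, j₀) : ℝ) / ((q : Fin n → ℤ) j₀ : ℝ)) := by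
  obtain ⟨i₀, hi₀⟩ := hmax
  have hl₀ : l (i₀, j₀) ≠ 0 := fun h0 =>
    hl (funext fun p => abs_nonpos_iff.1 (by simpa [h0] using hi₀ p))
  have hφ : Integrable φ := integrable_of_integral_eq_one hint
  set A : (Fin n → ℤ) → ℂ := fun q =>
    Complex.exp
        (((-(2 * Real.pi * ((∑ i : Fin m, (l (i, j₀) : ℝ) * θ i) / (q j₀ : ℝ))) : ℝ) : ℂ)
          * Complex.I) *
      ftRm φ (fun i => Ψ q * (l (i, j₀) : ℝ) / (q j₀ : ℝ)) with hA
  have hcoef (q : Fin n → ℤ) : fcoef (PhiQ φ (Ψ q) q θ) l = (Dset m n l).indicator A q := by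
    by_cases hq : q ∈ Dset m n l
    · rw [Set.indicator_of_mem hq]
      obtain ⟨k, hk⟩ := hq
      have hqj : q j₀ ≠ 0 := fun h0 => hl₀ (by rw [hk, h0, mul_zero])
      have hqj' : (q j₀ : ℝ) ≠ 0 := by exact_mod_cast hqj
      have hq0 : q ≠ 0 := fun h0 => hqj (by rw [h0]; rfl)
      rw [fcoef_PhiQ_of_eq hmeas hφ (hΨ q).1 hq0 θ hk, hA]
      have hkr (i : Fin m) : (l (i, j₀) : ℝ) = k i * q j₀ := by rw [hk]; push_cast; rfl
      simp only [hkr, conjChar]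
      congr 2
      · rw [Finset.sum_div]
        congr 5
        funext i
        field_simp
      · funext i
        field_simp
    · rw [Set.indicator_of_notMem hq, fcoef_PhiQ_of_notMem hmeas _ θ hq]
  have hsum : ∑' q : ↥(Q' ∩ Dset m n l), A q = ∑' q : Q', (Dset m n l).indicator A q := by
    rw [tsum_subtype (Q' ∩ Dset m n l) A, tsum_subtype Q' ((Dset m n l).indicator A),
      Set.indicator_indicator]
  change _ = _ * ∑' q : ↥(Q' ∩ Dset m n l), A q
  have := hfin.fintype
  rw [hsum, tsum_fintype, fcoef_eq]
  simp_rw [← hcoef, fcoef_eq]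
  rw [← integral_finsetSum Finset.univ fun (q : Q') _ =>
    integrableOn_PhiQ_mul_conjChar hmeas hφ (hΨ q).1 (q : Fin n → ℤ) θ _, ← integral_const_mul]
  refine integral_congr_ae (Filter.Eventually.of_forall fun x => ?_)
  simp only [FM, tsum_fintype]
  push_cast
  rw [mul_assoc, Finset.sum_mul]
end
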